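/- arXiv:1306.5339 — 2 statements merged into one kernel-verified Lean document; each statement's English description precedes it below -/
import Mathlib

section
/- For every real number t with 0 < t ≤ t₀, where t₀ := (1 − √5 + √(2(5 − √5)))/2, the value Q(t) := (−1 + 22t² + 16t³ − 33t⁴ + 16t⁶ + √(1 + 20t² − 26t⁴ + 20t⁶ + t⁸)) / (16t²(1 − t²)) satisfies 2 < Q(t) ≤ q₀, where q₀ := −3 + (3√5)/2 + (1/2)·√((125 − 41√5)/2). -/
/-- Squaring the numerator's polynomial part against the radicand, with the target value of the
quotient encoded by `a = 16 q - 22`. -/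
theorem gion_sq_sub_radicand (a t : ℝ) :
    (1 + a * t ^ 2 - 16 * t ^ 3 + (11 - a) * t ^ 4 - 16 * t ^ 6) ^ 2 -
        (1 + 20 * t ^ 2 - 26 * t ^ 4 + 20 * t ^ 6 + t ^ 8) =
      t ^ 2 * ((2 * a - 20) - 32 * t + (a ^ 2 - 2 * a + 48) * t ^ 2 - 32 * a * t ^ 3 +
        (204 + 22 * a - 2 * a ^ 2) * t ^ 4 + (32 * a - 352) * t ^ 5 +
        (a ^ 2 - 54 * a + 120) * t ^ 6 + 512 * t ^ 7 + (32 * a - 352) * t ^ 8 +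
        256 * t ^ 10) := by
  ring

theorem gion_lower_cofactor_neg {t : ℝ} (h0 : 0 < t) (h1 : t < 0.5576) :
    -1 + 4 * t - 10 * t ^ 2 + 7 * t ^ 3 - t ^ 4 - 10 * t ^ 5 + 16 * t ^ 6 - t ^ 7 +
      8 * t ^ 9 < 0 := by
  have h3 : t ^ 3 ≤ 0.5576 * t ^ 2 := by nlinarith [pow_pos h0 2]
  have h6 : t ^ 6 ≤ 0.5576 * t ^ 5 := by nlinarith [pow_pos h0 5]
  have h5 : t ^ 5 ≤ 0.5576 * t ^ 4 := by nlinarith [pow_pos h0 4]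
  have h7 : t ^ 7 ≤ 0.5576 * t ^ 6 := by nlinarith [pow_pos h0 6]
  have h8 : t ^ 8 ≤ 0.5576 * t ^ 7 := by nlinarith [pow_pos h0 7]
  have h9 : t ^ 9 ≤ 0.5576 * t ^ 8 := by nlinarith [pow_pos h0 8]
  nlinarith [sq_nonneg (t - 1 / 3), pow_pos h0 2, pow_pos h0 4, pow_pos h0 5, pow_pos h0 7]

theorem gion_lower {t : ℝ} (h0 : 0 < t) (h1 : t < 0.5576) :
    1 + 10 * t ^ 2 - 16 * t ^ 3 + t ^ 4 - 16 * t ^ 6 <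
      Real.sqrt (1 + 20 * t ^ 2 - 26 * t ^ 4 + 20 * t ^ 6 + t ^ 8) := by
  apply Real.lt_sqrt_of_sq_lt
  nlinarith [gion_sq_sub_radicand 10 t,
    mul_pos (pow_pos h0 3) (neg_pos.2 (gion_lower_cofactor_neg h0 h1))]

theorem gion_endpoint_root {s r : ℝ} (hs : s ^ 2 = 5) (hr : r ^ 2 = 10 - 2 * s) {a x : ℝ}
    (hx : x = (1 - s + r) / 2) (ha : a = 16 * (-3 + 3 * s / 2 + (s - 1 / 2) * r / 2) - 22) :
    (2 * a - 20) - 32 * x + (a ^ 2 - 2 * a + 48) * x ^ 2 - 32 * a * x ^ 3 +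
        (204 + 22 * a - 2 * a ^ 2) * x ^ 4 + (32 * a - 352) * x ^ 5 +
        (a ^ 2 - 54 * a + 120) * x ^ 6 + 512 * x ^ 7 + (32 * a - 352) * x ^ 8 +
        256 * x ^ 10 = 0 := by
  have hquartic : x ^ 4 - 2 * x ^ 3 - 6 * x ^ 2 + 2 * x + 1 = 0 := by
    subst hx
    grind
  have hax : a = -22 + 68 * x + 8 * x ^ 2 - 12 * x ^ 3 := by
    subst hx ha
    grind
  subst hax
  linear_combination (-64 + 232 * x - 256 * x ^ 2 - 672 * x ^ 3 + 1168 * x ^ 4 +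
    696 * x ^ 5 - 1056 * x ^ 6 - 288 * x ^ 7 + 144 * x ^ 8) * hquartic

theorem gion_upper_cofactor_nonneg {a x t : ℝ} (ha1 : 16.319 < a) (ha2 : a < 16.320)
    (hx1 : 0.5575 < x) (hx2 : x < 0.5576)
    (hroot : (2 * a - 20) - 32 * x + (a ^ 2 - 2 * a + 48) * x ^ 2 - 32 * a * x ^ 3 +
        (204 + 22 * a - 2 * a ^ 2) * x ^ 4 + (32 * a - 352) * x ^ 5 +
        (a ^ 2 - 54 * a + 120) * x ^ 6 + 512 * x ^ 7 + (32 * a - 352) * x ^ 8 +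
        256 * x ^ 10 = 0) (h0 : 0 < t) (htx : t ≤ x) :
    0 ≤ (2 * a - 20) - 32 * t + (a ^ 2 - 2 * a + 48) * t ^ 2 - 32 * a * t ^ 3 +
        (204 + 22 * a - 2 * a ^ 2) * t ^ 4 + (32 * a - 352) * t ^ 5 +
        (a ^ 2 - 54 * a + 120) * t ^ 6 + 512 * t ^ 7 + (32 * a - 352) * t ^ 8 +
        256 * t ^ 10 := by
  have hx0 : 0 < x := by linarith
  have hsq1 : 266.30 < a ^ 2 := by nlinarith
  have hsq2 : a ^ 2 < 266.35 := by nlinarith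
  obtain ⟨r8, e8⟩ : ∃ r, r = x * (-256) := ⟨_, rfl⟩
  obtain ⟨r7, e7⟩ : ∃ r, r = x * r8 - (32 * a - 352) := ⟨_, rfl⟩
  obtain ⟨r6, e6⟩ : ∃ r, r = x * r7 - 512 := ⟨_, rfl⟩
  obtain ⟨r5, e5⟩ : ∃ r, r = x * r6 - (a ^ 2 - 54 * a + 120) := ⟨_, rfl⟩
  obtain ⟨r4, e4⟩ : ∃ r, r = x * r5 - (32 * a - 352) := ⟨_, rfl⟩
  obtain ⟨r3, e3⟩ : ∃ r, r = x * r4 - (204 + 22 * a - 2 * a ^ 2) := ⟨_, rfl⟩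
  obtain ⟨r2, e2⟩ : ∃ r, r = x * r3 + 32 * a := ⟨_, rfl⟩
  obtain ⟨r1, e1⟩ : ∃ r, r = x * r2 - (a ^ 2 - 2 * a + 48) := ⟨_, rfl⟩
  obtain ⟨r0, e0⟩ : ∃ r, r = x * r1 + 32 := ⟨_, rfl⟩
  have b8 : -143 < r8 ∧ r8 < -142 := by constructor <;> linarith
  have b7 : -251 < r7 ∧ r7 < -249 := by
    constructor <;>
      linarith [mul_lt_mul_of_pos_left b8.1 hx0, mul_lt_mul_of_pos_left b8.2 hx0]
  have b6 : -653 < r6 ∧ r6 < -650 := by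
    constructor <;>
      linarith [mul_lt_mul_of_pos_left b7.1 hx0, mul_lt_mul_of_pos_left b7.2 hx0]
  have b5 : 130 < r5 ∧ r5 < 133 := by
    constructor <;>
      linarith [mul_lt_mul_of_pos_left b6.1 hx0, mul_lt_mul_of_pos_left b6.2 hx0]
  have b4 : -98.5 < r4 ∧ r4 < -95.5 := by
    constructor <;>
      linarith [mul_lt_mul_of_pos_left b5.1 hx0, mul_lt_mul_of_pos_left b5.2 hx0]
  have b3 : -86 < r3 ∧ r3 < -83 := by
    constructor <;>
      linarith [mul_lt_mul_of_pos_left b4.1 hx0, mul_lt_mul_of_pos_left b4.2 hx0]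
  have b2 : 474 < r2 ∧ r2 < 477 := by
    constructor <;>
      linarith [mul_lt_mul_of_pos_left b3.1 hx0, mul_lt_mul_of_pos_left b3.2 hx0]
  have b1 : -18 < r1 ∧ r1 < -15 := by
    constructor <;>
      linarith [mul_lt_mul_of_pos_left b2.1 hx0, mul_lt_mul_of_pos_left b2.2 hx0]
  have b0 : 21 < r0 := by linarith [mul_lt_mul_of_pos_left b1.1 hx0]
  have factor : (2 * a - 20) - 32 * t + (a ^ 2 - 2 * a + 48) * t ^ 2 - 32 * a * t ^ 3 +
        (204 + 22 * a - 2 * a ^ 2) * t ^ 4 + (32 * a - 352) * t ^ 5 +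
        (a ^ 2 - 54 * a + 120) * t ^ 6 + 512 * t ^ 7 + (32 * a - 352) * t ^ 8 +
        256 * t ^ 10 =
      (x - t) * (r0 + r1 * t + r2 * t ^ 2 + r3 * t ^ 3 + r4 * t ^ 4 + r5 * t ^ 5 + r6 * t ^ 6 +
        r7 * t ^ 7 + r8 * t ^ 8 - 256 * t ^ 9) := by
    subst e0 e1 e2 e3 e4 e5 e6 e7 e8
    linear_combination hroot
  rw [factor]
  refine mul_nonneg (sub_nonneg.2 htx) ?_
  have step (n : ℕ) : t ^ (n + 1) ≤ 0.5576 * t ^ n := by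
    rw [pow_succ, mul_comm]
    exact mul_le_mul_of_nonneg_right (htx.trans hx2.le) (pow_pos h0 n).le
  have term {c r : ℝ} (n : ℕ) (h : c < r) : c * t ^ n ≤ r * t ^ n :=
    mul_le_mul_of_nonneg_right h.le (pow_pos h0 n).le
  linarith [term 1 b1.1, term 2 b2.1, term 3 b3.1, term 4 b4.1, term 5 b5.1, term 6 b6.1,
    term 7 b7.1, term 8 b8.1, step 0, step 1, step 2, step 3, step 4, step 5, step 6, step 7,
    step 8, pow_pos h0 2, pow_pos h0 5, pow_one t, pow_zero t]

theorem gion_upper {a x t : ℝ} (ha1 : 16.319 < a) (ha2 : a < 16.320)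
    (hx1 : 0.5575 < x) (hx2 : x < 0.5576)
    (hroot : (2 * a - 20) - 32 * x + (a ^ 2 - 2 * a + 48) * x ^ 2 - 32 * a * x ^ 3 +
        (204 + 22 * a - 2 * a ^ 2) * x ^ 4 + (32 * a - 352) * x ^ 5 +
        (a ^ 2 - 54 * a + 120) * x ^ 6 + 512 * x ^ 7 + (32 * a - 352) * x ^ 8 +
        256 * x ^ 10 = 0) (h0 : 0 < t) (htx : t ≤ x) :
    Real.sqrt (1 + 20 * t ^ 2 - 26 * t ^ 4 + 20 * t ^ 6 + t ^ 8) ≤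
      1 + a * t ^ 2 - 16 * t ^ 3 + (11 - a) * t ^ 4 - 16 * t ^ 6 := by
  rw [Real.sqrt_le_iff]
  constructor
  · have step (n : ℕ) : t ^ (n + 1) ≤ 0.5576 * t ^ n := by
      rw [pow_succ, mul_comm]
      exact mul_le_mul_of_nonneg_right (htx.trans hx2.le) (pow_pos h0 n).le
    have := mul_le_mul_of_nonneg_right ha1.le (pow_pos h0 2).le
    have := mul_le_mul_of_nonneg_right ha2.le (pow_pos h0 4).le
    linarith [step 2, step 3, step 4, step 5, pow_pos h0 2]
  · have := mul_nonneg (pow_pos h0 2).le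
      (gion_upper_cofactor_nonneg ha1 ha2 hx1 hx2 hroot h0 htx)
    rw [← gion_sq_sub_radicand] at this
    linarith


theorem gion_Q_range (t₀ q₀ : ℝ)
    (ht₀ : t₀ = (1 - Real.sqrt 5 + Real.sqrt (2 * (5 - Real.sqrt 5))) / 2)
    (hq₀ : q₀ = -3 + 3 * Real.sqrt 5 / 2 +
      (1 / 2) * Real.sqrt ((125 - 41 * Real.sqrt 5) / 2))
    (t : ℝ) (ht1 : 0 < t) (ht2 : t ≤ t₀) :
    2 < (-1 + 22 * t ^ 2 + 16 * t ^ 3 - 33 * t ^ 4 + 16 * t ^ 6 +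
        Real.sqrt (1 + 20 * t ^ 2 - 26 * t ^ 4 + 20 * t ^ 6 + t ^ 8)) /
        (16 * t ^ 2 * (1 - t ^ 2)) ∧
      (-1 + 22 * t ^ 2 + 16 * t ^ 3 - 33 * t ^ 4 + 16 * t ^ 6 +
        Real.sqrt (1 + 20 * t ^ 2 - 26 * t ^ 4 + 20 * t ^ 6 + t ^ 8)) /
        (16 * t ^ 2 * (1 - t ^ 2)) ≤ q₀ := by
  set s := Real.sqrt 5
  have hs : s ^ 2 = 5 := Real.sq_sqrt (by norm_num)
  have hs0 : 0 ≤ s := Real.sqrt_nonneg 5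
  have hs1 : 2.236067 < s := by nlinarith
  have hs2 : s < 2.236068 := by nlinarith
  set r := Real.sqrt (2 * (5 - s)) with hr_def
  have hr : r ^ 2 = 10 - 2 * s := by
    rw [hr_def, Real.sq_sqrt (by linarith)]
    ring
  have hr0 : 0 ≤ r := Real.sqrt_nonneg _
  have hr1 : 2.35113 < r := by nlinarith
  have hr2 : r < 2.35116 := by nlinarith
  have hnested : Real.sqrt ((125 - 41 * s) / 2) = (s - 1 / 2) * r := by
    rw [Real.sqrt_eq_iff_mul_self_eq (by linarith) (mul_nonneg (by linarith) hr0)]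
    linear_combination -(s - 1 / 2) ^ 2 * hr + (2 * s - 12) * hs
  rw [hnested] at hq₀
  have hq1 : 2.39495 < q₀ := by nlinarith
  have hq2 : q₀ < 2.39499 := by nlinarith
  have hx1 : 0.5575 < t₀ := by linarith
  have hx2 : t₀ < 0.5576 := by linarith
  have hroot := gion_endpoint_root hs hr ht₀ (a := 16 * q₀ - 22) (by rw [hq₀]; ring)
  have hlower := gion_lower ht1 (ht2.trans_lt hx2)
  have hupper := gion_upper (by linarith) (by linarith) hx1 hx2 hroot ht1 ht2
  have hden : 0 < 16 * t ^ 2 * (1 - t ^ 2) := mul_pos (by positivity) (by nlinarith)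
  rw [lt_div_iff₀ hden, div_le_iff₀ hden]
  constructor
  · linarith
  · linarith
end

section
/- The polynomial 8X¹⁰ + 3X⁸ + 16X⁷ − (55/4)X⁶ + 3X⁵ + (15/4)X⁴ − 14X³ + (27/4)X² − X + 1/4 (that is, P(X, q) with q = 9/4, where P(X, q) = 8X¹⁰ + (16q − 33)X⁸ + 16X⁷ + (8q² − 49q + 56)X⁶ + (16q − 33)X⁵ − (16q² − 55q + 39)X⁴ − (16q − 22)X³ + (8q² − 23q + 18)X² − X + q − 2) is irreducible over ℚ. -/
/-- A primitive polynomial is irreducible if its image under a ring homomorphism to a domain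
that does not kill its leading coefficient is irreducible. -/
theorem Polynomial.IsPrimitive.irreducible_of_irreducible_map {R S : Type*} [CommRing R]
    [IsDomain R] [CommRing S] [IsDomain S] (φ : R →+* S) {f : Polynomial R} (hf : f.IsPrimitive)
    (hlc : φ f.leadingCoeff ≠ 0) (hirr : Irreducible (f.map φ)) : Irreducible f := by
  have aux : ∀ g h : Polynomial R, f = g * h → IsUnit (g.map φ) → IsUnit g := by
    rintro g h rfl hg
    rw [leadingCoeff_mul, map_mul] at hlc
    have hdeg : g.natDegree = 0 := by
      rw [← natDegree_map_of_leadingCoeff_ne_zero φ (left_ne_zero_of_mul hlc)]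
      exact natDegree_eq_zero_of_isUnit hg
    rw [eq_C_of_natDegree_eq_zero hdeg] at hf ⊢
    exact isUnit_C.2 (hf _ (dvd_mul_right _ _))
  refine ⟨fun hu => hirr.not_isUnit (hu.map (mapRingHom φ)), fun g h hgh => ?_⟩
  have hmap : f.map φ = g.map φ * h.map φ := by rw [hgh, Polynomial.map_mul]
  exact (hirr.isUnit_or_isUnit hmap).imp (aux g h hgh) (aux h g (hgh.trans (mul_comm g h)))

/-- A polynomial over a finite field is irreducible as soon as it has no root `a` in an extension
field with `a ^ (q ^ d) = a`, for `d` positive and at most half the degree. -/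
theorem Polynomial.irreducible_of_forall_pow_card_pow_ne {F : Type} [Field F] [Fintype F]
    {f : Polynomial F} (hf : 0 < f.natDegree)
    (H : ∀ (K : Type) [Field K] [Algebra F K] (a : K) (d : ℕ), 0 < d → d ≤ f.natDegree / 2 →
      aeval a f = 0 → a ^ Fintype.card F ^ d ≠ a) : Irreducible f := by
  have hf0 : f ≠ 0 := by
    rintro rfl
    simp at hf
  have hfu : ¬IsUnit f := fun hu => hf.ne' (natDegree_eq_zero_of_isUnit hu)
  rw [irreducible_iff_lt_natDegree_lt hf0 hfu]
  intro q hq hqd hqf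
  rw [Finset.mem_Ioc] at hqd
  obtain ⟨g, hg, hgq⟩ := exists_irreducible_of_natDegree_pos hqd.1
  have : Fact (Irreducible g) := ⟨hg⟩
  have : FiniteDimensional F (AdjoinRoot g) := (AdjoinRoot.powerBasis hg.ne_zero).finite
  have : Finite (AdjoinRoot g) := Module.finite_of_finite F
  have := Fintype.ofFinite (AdjoinRoot g)
  have hcard : Fintype.card (AdjoinRoot g) = Fintype.card F ^ g.natDegree := by
    rw [Module.card_eq_pow_finrank (K := F), (AdjoinRoot.powerBasis hg.ne_zero).finrank,
      AdjoinRoot.powerBasis_dim]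
  refine H (AdjoinRoot g) (AdjoinRoot.root g) g.natDegree hg.natDegree_pos
    ((natDegree_le_of_dvd hgq hq.ne_zero).trans hqd.2) ?_ ?_
  · rw [AdjoinRoot.aeval_eq, AdjoinRoot.mk_eq_zero]
    exact hgq.trans hqf
  · rw [← hcard, FiniteField.pow_card]

/-- In characteristic `13`, no root of the cleared polynomial `4 P(X, 9/4)` lies in a field with
`13 ^ d` elements for `1 ≤ d ≤ 5`: modulo `P`, each `X ^ (13 ^ d) - X` has an explicit inverse. -/
theorem gion_pow_ne_self {K : Type*} [Field K] [CharP K 13] {a : K} {d : ℕ} (hd0 : 0 < d)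
    (hd5 : d ≤ 5)
    (hF : 32 * a ^ 10 + 12 * a ^ 8 + 64 * a ^ 7 - 55 * a ^ 6 + 12 * a ^ 5 + 15 * a ^ 4 -
      56 * a ^ 3 + 27 * a ^ 2 - 4 * a + 1 = 0) :
    a ^ 13 ^ d ≠ a := by
  intro h
  have : Fact (Nat.Prime 13) := ⟨by norm_num⟩
  have h13 : (13 : K) = 0 := CharP.cast_eq_zero K 13
  have h1 : a ^ 13 = -2 * a ^ 9 + 6 * a ^ 8 - 6 * a ^ 7 - 5 * a ^ 6 - 2 * a ^ 5 + a ^ 3 - a ^ 2 - a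
      - 4 := by
    linear_combination (-2 * a ^ 3 + 4 * a + 4) * hF + (5 * a ^ 13 - 8 * a ^ 11 - 12 * a ^ 9 - 22 *
      a ^ 8 + 5 * a ^ 6 - 4 * a ^ 5 + 12 * a ^ 4 + 9 * a ^ 3 - 7 * a ^ 2 + a) * h13
  have h2 : a ^ 26 = -3 * a ^ 9 + 4 * a ^ 8 - 2 * a ^ 7 + 5 * a ^ 6 + 6 * a ^ 5 - 6 * a ^ 4 - 5 * a
      ^ 3 + 5 * a ^ 2 - 6 * a - 6 := by
    linear_combination a ^ 13 * h1 + (-2 * a ^ 9 + 6 * a ^ 8 - 6 * a ^ 7 - 5 * a ^ 6 - 2 * a ^ 5 + a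
      ^ 3 - a ^ 2 - a - 4) * h1 + (5 * a ^ 8 - 4 * a ^ 7 - 2 * a ^ 5 - 3 * a ^ 4 - 2 * a ^ 3 - 2 * a
      - 4) * hF + (-12 * a ^ 18 + 8 * a ^ 17 - 20 * a ^ 15 + 47 * a ^ 14 - 12 * a ^ 13 + 14 * a ^ 12
      + 42 * a ^ 11 - 20 * a ^ 10 + 9 * a ^ 9 + 6 * a ^ 8 + 10 * a ^ 7 - 15 * a ^ 6 + 10 * a ^ 5 - 4
      * a ^ 4 - 13 * a ^ 3 + 8 * a ^ 2 + 2) * h13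
  have h3 : a ^ 39 = -a ^ 9 + 2 * a ^ 8 + 4 * a ^ 7 + 6 * a ^ 6 - a ^ 5 + 6 * a ^ 3 - 4 * a ^ 2 + 2
      * a - 4 := by
    linear_combination a ^ 13 * h2 + (-3 * a ^ 9 + 4 * a ^ 8 - 2 * a ^ 7 + 5 * a ^ 6 + 6 * a ^ 5 - 6
      * a ^ 4 - 5 * a ^ 3 + 5 * a ^ 2 - 6 * a - 6) * h1 + (a ^ 8 - 3 * a ^ 6 - 5 * a ^ 5 - 6 * a ^ 4
      - 5 * a ^ 2 - 3 * a + 2) * hF + (-2 * a ^ 18 - 2 * a ^ 17 + 10 * a ^ 16 + 5 * a ^ 15 + 23 * a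
      ^ 14 + 20 * a ^ 13 + 22 * a ^ 12 + 20 * a ^ 11 - 13 * a ^ 10 + 26 * a ^ 9 - 19 * a ^ 8 - 31 *
      a ^ 7 + 29 * a ^ 6 - 21 * a ^ 5 - 3 * a ^ 4 + 14 * a ^ 3 - 5 * a ^ 2 + 3 * a + 2) * h13
  have h4 : a ^ 52 = 6 * a ^ 9 + 3 * a ^ 8 - 2 * a ^ 7 - 5 * a ^ 6 - 5 * a ^ 5 - 4 * a ^ 4 - a ^ 3 -
      6 * a - 5 := by
    linear_combination a ^ 13 * h3 + (-a ^ 9 + 2 * a ^ 8 + 4 * a ^ 7 + 6 * a ^ 6 - a ^ 5 + 6 * a ^ 3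
      - 4 * a ^ 2 + 2 * a - 4) * h1 + (-4 * a ^ 8 - 6 * a ^ 7 + a ^ 6 - 3 * a ^ 5 - 4 * a ^ 4 - 2 *
      a ^ 3 + 3 * a ^ 2 - 5 * a - 5) * hF + (10 * a ^ 18 + 14 * a ^ 17 + 2 * a ^ 16 + 33 * a ^ 15 +
      22 * a ^ 14 - 24 * a ^ 13 + 22 * a ^ 12 + 13 * a ^ 11 - 18 * a ^ 10 + 5 * a ^ 9 + 28 * a ^ 8 -
      7 * a ^ 7 - 21 * a ^ 6 + 27 * a ^ 5 - 22 * a ^ 4 - 12 * a ^ 3 + 10 * a ^ 2 - a + 2) * h13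
  have h5 : a ^ 65 = -6 * a ^ 9 + 2 * a ^ 8 + 5 * a ^ 7 - 2 * a ^ 6 + 4 * a ^ 5 - 3 * a ^ 4 - 3 * a
      ^ 3 + 4 * a ^ 2 + 3 * a - 6 := by
    linear_combination a ^ 13 * h4 + (6 * a ^ 9 + 3 * a ^ 8 - 2 * a ^ 7 - 5 * a ^ 6 - 5 * a ^ 5 - 4
      * a ^ 4 - a ^ 3 - 6 * a - 5) * h1 + (-2 * a ^ 8 + 5 * a ^ 7 + 6 * a ^ 6 + 3 * a ^ 5 - 5 * a ^
      4 - 3 * a ^ 3 - 6 * a ^ 2) * hF + (4 * a ^ 18 - 10 * a ^ 17 - 14 * a ^ 16 - 6 * a ^ 15 - 29 *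
      a ^ 14 - a ^ 13 + 31 * a ^ 12 + 24 * a ^ 11 + 18 * a ^ 10 + 30 * a ^ 9 - 15 * a ^ 8 - 12 * a ^
      7 + 10 * a ^ 6 - 19 * a ^ 5 + 13 * a ^ 4 - a ^ 3 + a ^ 2 + 2 * a + 2) * h13
  have h6 : a ^ 78 = 5 * a ^ 8 + 5 * a ^ 7 - 2 * a ^ 6 + 4 * a ^ 5 + 6 * a ^ 4 - 6 * a ^ 3 - a ^ 2 +
      6 * a - 6 := by
    linear_combination a ^ 13 * h5 + (-6 * a ^ 9 + 2 * a ^ 8 + 5 * a ^ 7 - 2 * a ^ 6 + 4 * a ^ 5 - 3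
      * a ^ 4 - 3 * a ^ 3 + 4 * a ^ 2 + 3 * a - 6) * h1 + (2 * a ^ 8 + 2 * a ^ 7 - 2 * a ^ 6 + 5 * a
      ^ 5 + 6 * a ^ 4 + 4 * a ^ 3 + 4 * a + 4) * hF + (-4 * a ^ 18 - 8 * a ^ 17 + 6 * a ^ 16 - 20 *
      a ^ 15 - 18 * a ^ 14 + 3 * a ^ 13 - 46 * a ^ 12 - 15 * a ^ 11 + 2 * a ^ 10 - 7 * a ^ 9 - 14 *
      a ^ 8 + 6 * a ^ 7 + 22 * a ^ 6 - 15 * a ^ 5 + 14 * a ^ 4 + 9 * a ^ 3 - 8 * a ^ 2 + 2) * h13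
  have h7 : a ^ 91 = 4 * a ^ 9 + 3 * a ^ 8 + a ^ 7 - 2 * a ^ 6 + 3 * a ^ 5 - 6 * a ^ 4 - 6 * a ^ 3 -
      3 * a ^ 2 - 3 * a + 5 := by
    linear_combination a ^ 13 * h6 + (5 * a ^ 8 + 5 * a ^ 7 - 2 * a ^ 6 + 4 * a ^ 5 + 6 * a ^ 4 - 6
      * a ^ 3 - a ^ 2 + 6 * a - 6) * h1 + (-6 * a ^ 7 - a ^ 6 + 4 * a ^ 5 - 5 * a ^ 4 - 2 * a ^ 2 -
      4 * a + 6) * hF + (14 * a ^ 17 + 4 * a ^ 16 - 4 * a ^ 15 + 37 * a ^ 14 - 25 * a ^ 13 - 7 * a ^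
      12 + 53 * a ^ 11 - 64 * a ^ 10 + 26 * a ^ 9 + 23 * a ^ 8 - 75 * a ^ 7 + 44 * a ^ 6 - 12 * a ^
      5 - 20 * a ^ 4 + 35 * a ^ 3 - 13 * a ^ 2 + a + 1) * h13
  have h8 : a ^ 104 = 2 * a ^ 9 - 6 * a ^ 8 + 4 * a ^ 7 + 2 * a ^ 6 - 6 * a ^ 5 - 6 * a ^ 4 + 3 * a
      ^ 3 - 3 * a ^ 2 + 2 * a + 3 := by
    linear_combination a ^ 13 * h7 + (4 * a ^ 9 + 3 * a ^ 8 + a ^ 7 - 2 * a ^ 6 + 3 * a ^ 5 - 6 * a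
      ^ 4 - 6 * a ^ 3 - 3 * a ^ 2 - 3 * a + 5) * h1 + (3 * a ^ 8 + 3 * a ^ 7 - 3 * a ^ 6 + 5 * a ^ 5
      - 2 * a ^ 4 + a ^ 3 + 4 * a + 3) * hF + (-8 * a ^ 18 - 6 * a ^ 17 + 4 * a ^ 16 - 32 * a ^ 15 +
      2 * a ^ 14 + 20 * a ^ 13 - 44 * a ^ 12 + 32 * a ^ 11 - 12 * a ^ 10 - 21 * a ^ 9 + 13 * a ^ 8 -
      21 * a ^ 7 + 18 * a ^ 6 - 11 * a ^ 5 + 17 * a ^ 4 + 7 * a ^ 3 - 4 * a ^ 2 + a - 2) * h13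
  have h9 : a ^ 117 = -4 * a ^ 9 - 4 * a ^ 8 - a ^ 7 + a ^ 6 + 3 * a ^ 5 - 5 * a ^ 4 + 5 * a ^ 3 - 4
      * a ^ 2 + 3 * a + 5 := by
    linear_combination a ^ 13 * h8 + (2 * a ^ 9 - 6 * a ^ 8 + 4 * a ^ 7 + 2 * a ^ 6 - 6 * a ^ 5 - 6
      * a ^ 4 + 3 * a ^ 3 - 3 * a ^ 2 + 2 * a + 3) * h1 + (-5 * a ^ 8 + 4 * a ^ 7 + 5 * a ^ 6 + a ^
      5 - a ^ 4 - 3 * a ^ 3 - a ^ 2 - 4 * a - 4) * hF + (12 * a ^ 18 - 8 * a ^ 17 - 12 * a ^ 16 + 22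
      * a ^ 15 - 41 * a ^ 14 + 20 * a ^ 12 - 3 * a ^ 11 + 43 * a ^ 10 + 9 * a ^ 9 + 21 * a ^ 8 - a ^
      7 - 24 * a ^ 6 + 11 * a ^ 5 - 9 * a ^ 4 - 10 * a ^ 3 + 8 * a ^ 2 - 2 * a - 1) * h13
  have e2 : frobenius K 13 (-2 * a ^ 9 + 6 * a ^ 8 - 6 * a ^ 7 - 5 * a ^ 6 - 2 * a ^ 5 + a ^ 3 - a ^
      2 - a - 4) =
      -a ^ 9 - 5 * a ^ 8 - 3 * a ^ 7 + 3 * a ^ 6 - 2 * a ^ 5 + 5 * a ^ 4 - a ^ 3 - 3 * a ^ 2 - 3 * a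
        - 4 := by
    simp only [map_add, map_sub, map_mul, map_neg, map_pow, map_ofNat, frobenius_def]
    linear_combination (-1) * h1 + (-1) * h2 + (1) * h3 + (-2) * h5 + (-5) * h6 + (-6) * h7 + (6) *
      h8 + (-2) * h9 + (a ^ 9 - 6 * a ^ 8 + 3 * a ^ 6 - 7 * a ^ 5 - a ^ 4 + 7 * a ^ 3 + 2) * h13
  have e3 : frobenius K 13 (-a ^ 9 - 5 * a ^ 8 - 3 * a ^ 7 + 3 * a ^ 6 - 2 * a ^ 5 + 5 * a ^ 4 - a ^
      3 - 3 * a ^ 2 - 3 * a - 4) =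
      a ^ 9 + 6 * a ^ 8 + 6 * a ^ 7 + a ^ 6 - a ^ 5 - 3 * a ^ 4 - 4 * a ^ 2 - 3 * a + 3 := by
    simp only [map_add, map_sub, map_mul, map_neg, map_pow, map_ofNat, frobenius_def]
    linear_combination (-3) * h1 + (-3) * h2 + (-1) * h3 + (5) * h4 + (-2) * h5 + (3) * h6 + (-3) *
      h7 + (-5) * h8 + (-1) * h9 + (3 * a ^ 9 + a ^ 8 - a ^ 7 - 3 * a ^ 6 - a ^ 5 + 6 * a ^ 4 - a ^
      3 + a ^ 2 - 3) * h13
  have e4 : frobenius K 13 (a ^ 9 + 6 * a ^ 8 + 6 * a ^ 7 + a ^ 6 - a ^ 5 - 3 * a ^ 4 - 4 * a ^ 2 -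
      3 * a + 3) =
      -a ^ 9 + 3 * a ^ 8 - 4 * a ^ 7 - 2 * a ^ 6 - 5 * a ^ 5 - 6 * a ^ 4 + 4 * a ^ 3 + 3 * a ^ 2 + 6
        * a + 3 := by
    simp only [map_add, map_sub, map_mul, map_pow, map_ofNat, frobenius_def]
    linear_combination (-3) * h1 + (-4) * h2 + (-3) * h4 + (-1) * h5 + (1) * h6 + (6) * h7 + (6) *
      h8 + (1) * h9 + (3 * a ^ 9 - 5 * a ^ 8 + 5 * a ^ 7 + a ^ 6 - a ^ 5 - 2 * a ^ 4 - 5 * a ^ 2 + 3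
      * a + 8) * h13
  have e5 : frobenius K 13 (-a ^ 9 + 3 * a ^ 8 - 4 * a ^ 7 - 2 * a ^ 6 - 5 * a ^ 5 - 6 * a ^ 4 + 4 *
      a ^ 3 + 3 * a ^ 2 + 6 * a + 3) =
      2 * a ^ 9 + 5 * a ^ 8 - a ^ 7 + a ^ 6 - 3 * a ^ 5 - 6 * a ^ 4 - 2 * a ^ 3 - 5 * a ^ 2 - 5 * a
        + 1 := by
    simp only [map_add, map_sub, map_mul, map_neg, map_pow, map_ofNat, frobenius_def]
    linear_combination (6) * h1 + (3) * h2 + (4) * h3 + (-6) * h4 + (-5) * h5 + (-2) * h6 + (-4) *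
      h7 + (3) * h8 + (-1) * h9 + (-3 * a ^ 9 - a ^ 8 - 3 * a ^ 7 + 5 * a ^ 6 - 2 * a ^ 5 + 2 * a ^
      4 + 6 * a ^ 3 - a ^ 2 + a) * h13
  have e1 : frobenius K 13 a = _ := h1
  rw [← iterate_frobenius] at h
  apply one_ne_zero (α := K)
  interval_cases d <;>
    simp only [Function.iterate_succ_apply, Function.iterate_zero_apply, e1, e2, e3, e4, e5] at h
  · linear_combination (-6 * a ^ 9 - a ^ 8 - 4 * a ^ 7 + 3 * a ^ 6 + 3 * a ^ 5 - 3 * a ^ 4 - 5 * a ^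
      2 + 2 * a - 6) * h + (-2 * a ^ 8 - 3 * a ^ 7 + 2 * a ^ 6 - 4 * a ^ 5 + 3 * a ^ 4 + 4 * a ^ 3 -
      6 * a ^ 2 - 5 * a + 3) * hF + (4 * a ^ 18 + 10 * a ^ 17 - 6 * a ^ 16 + 22 * a ^ 15 - 7 * a ^
      14 - 29 * a ^ 13 + 49 * a ^ 12 - 31 * a ^ 11 - 15 * a ^ 10 + 60 * a ^ 9 - 32 * a ^ 8 - 16 * a
      ^ 7 + 33 * a ^ 6 - 30 * a ^ 5 - 13 * a ^ 4 + 21 * a ^ 3 - 9 * a ^ 2 + a - 2) * h13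
  · linear_combination (5 * a ^ 9 + 3 * a ^ 8 + 4 * a ^ 7 - 6 * a ^ 6 - 3 * a ^ 5 - 6 * a ^ 4 - 3 *
      a ^ 3 - 3 * a ^ 2 - 3 * a - 2) * h + (3 * a ^ 8 - 4 * a ^ 7 + 4 * a ^ 6 - a ^ 5 - 4 * a ^ 4 -
      4 * a ^ 3 + 6 * a ^ 2 + 4 * a + 6) * hF + (-7 * a ^ 18 + 12 * a ^ 17 - 10 * a ^ 16 - 8 * a ^
      15 + 37 * a ^ 14 - 34 * a ^ 13 + 9 * a ^ 12 + 20 * a ^ 11 - 41 * a ^ 10 - 17 * a ^ 9 - 4 * a ^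
      8 - 28 * a ^ 7 + 2 * a ^ 6 + 20 * a ^ 5 - 6 * a ^ 4 + 17 * a ^ 3 - 14 * a ^ 2 - 1) * h13
  · linear_combination (5 * a ^ 9 - 4 * a ^ 8 - 5 * a ^ 6 - 6 * a ^ 5 + 3 * a ^ 4 + 4 * a ^ 2 - 5 *
      a - 2) * h + (-3 * a ^ 8 + 5 * a ^ 6 - 3 * a ^ 5 - 4 * a ^ 4 - 3 * a ^ 3 + 2 * a ^ 2 - 4 * a -
      6) * hF + (7 * a ^ 18 - 2 * a ^ 17 - 10 * a ^ 16 + 24 * a ^ 15 - 4 * a ^ 14 - 6 * a ^ 13 + 39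
      * a ^ 12 + 2 * a ^ 11 + 11 * a ^ 10 + 6 * a ^ 9 + 21 * a ^ 8 + 3 * a ^ 7 - 29 * a ^ 6 + 25 * a
      ^ 5 - 15 * a ^ 4 - 17 * a ^ 3 + 8 * a ^ 2 - a + 1) * h13
  · linear_combination (-2 * a ^ 9 + 4 * a ^ 8 + 6 * a ^ 7 - 3 * a ^ 6 + 6 * a ^ 5 - 4 * a ^ 3 + 2 *
      a ^ 2 - 5 * a + 2) * h + (4 * a ^ 8 + 6 * a ^ 7 - 6 * a ^ 6 - 2 * a ^ 5 + 6 * a ^ 4 + 5 * a ^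
      3 - 3 * a ^ 2 - 2 * a - 5) * hF + (-10 * a ^ 18 - 14 * a ^ 17 + 10 * a ^ 16 - 21 * a ^ 15 - 19
      * a ^ 14 + 40 * a ^ 13 - 18 * a ^ 12 - 19 * a ^ 11 + 39 * a ^ 10 - 12 * a ^ 8 + 38 * a ^ 7 - 8
      * a ^ 6 - 17 * a ^ 5 + 8 * a ^ 4 - 18 * a ^ 3 + 11 * a ^ 2 - a) * h13
  · linear_combination (-4 * a ^ 9 + a ^ 8 + 5 * a ^ 7 + a ^ 5 - 4 * a ^ 4 - 6 * a ^ 3 - 2 * a ^ 2 -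
      a - 6) * h + (-3 * a ^ 8 + 3 * a ^ 7 + 5 * a ^ 6 + a ^ 5 - 4 * a ^ 4 - 4 * a ^ 3 - 4 * a ^ 2 +
      6 * a - 6) * hF + (8 * a ^ 18 - 6 * a ^ 17 - 11 * a ^ 16 + 8 * a ^ 15 - 23 * a ^ 14 - 2 * a ^
      13 + 34 * a ^ 12 - 5 * a ^ 11 + 34 * a ^ 10 + 18 * a ^ 9 - 36 * a ^ 8 + 41 * a ^ 7 - 38 * a ^
      6 - 18 * a ^ 5 + 34 * a ^ 4 - 41 * a ^ 3 + 12 * a ^ 2 - 5 * a + 1) * h13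

open Polynomial in
theorem gion_P_irreducible :
    Irreducible (8 * X ^ 10 + 3 * X ^ 8 + 16 * X ^ 7 - C (55 / 4) * X ^ 6 +
      3 * X ^ 5 + C (15 / 4) * X ^ 4 - 14 * X ^ 3 + C (27 / 4) * X ^ 2 -
      X + C (1 / 4) : ℚ[X]) := by
  set f : ℤ[X] :=
    32 * X ^ 10 + 12 * X ^ 8 + 64 * X ^ 7 - 55 * X ^ 6 + 12 * X ^ 5 + 15 * X ^ 4 -
      56 * X ^ 3 + 27 * X ^ 2 - 4 * X + 1 with hf
  have hdeg : f.natDegree = 10 := by rw [hf]; compute_degree!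
  have hlead : f.leadingCoeff = 32 := by
    rw [leadingCoeff, hdeg, hf]; simp [coeff_X, coeff_one, coeff_ofNat_mul]
  have hprim : f.IsPrimitive := by
    intro r hr
    rw [C_dvd_iff_dvd_coeff] at hr
    have h0 : f.coeff 0 = 1 := by rw [hf]; simp
    exact isUnit_of_dvd_one (h0 ▸ hr 0)
  have : Fact (Nat.Prime 13) := ⟨by norm_num⟩
  have hlead13 : Int.castRingHom (ZMod 13) f.leadingCoeff ≠ 0 := by
    rw [hlead, eq_intCast, ne_eq, ZMod.intCast_zmod_eq_zero_iff_dvd]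
    norm_num
  have hdeg13 : (f.map (Int.castRingHom (ZMod 13))).natDegree = 10 := by
    rw [natDegree_map_of_leadingCoeff_ne_zero _ hlead13, hdeg]
  have hirr : Irreducible f := by
    refine hprim.irreducible_of_irreducible_map (Int.castRingHom (ZMod 13)) hlead13 ?_
    refine irreducible_of_forall_pow_card_pow_ne (by omega) fun K _ _ a d hd0 hd hroot => ?_
    have : CharP K 13 := charP_of_injective_algebraMap (algebraMap (ZMod 13) K).injective 13
    rw [ZMod.card]
    refine gion_pow_ne_self hd0 (by omega) ?_
    simpa [hf, map_ofNat] using hroot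
  rw [IsPrimitive.Int.irreducible_iff_irreducible_map_cast hprim] at hirr
  have hu : IsUnit (C (1 / 4) : ℚ[X]) := isUnit_C.2 (IsUnit.mk0 _ (by norm_num))
  convert (irreducible_isUnit_mul hu).2 hirr using 1
  have hdiv : ∀ r : ℚ, (C (r / 4) : ℚ[X]) = C r * C (1 / 4) := fun r => by rw [← C_mul]; ring_nf
  have hquarter : (C (1 / 4) : ℚ[X]) * 4 = 1 := by
    rw [← C_ofNat, ← C_mul]
    norm_num
  rw [hdiv 55, hdiv 15, hdiv 27, hf]
  simp only [Polynomial.map_add, Polynomial.map_sub, Polynomial.map_mul, Polynomial.map_pow,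
    Polynomial.map_ofNat, Polynomial.map_one, map_X, map_ofNat]
  linear_combination (-8 * X ^ 10 - 3 * X ^ 8 - 16 * X ^ 7 - 3 * X ^ 5 + 14 * X ^ 3 + X) * hquarter
end
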